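/- arXiv:1902.10138 — 2 statements merged into one kernel-verified Lean document; each statement's English description precedes it below -/
import Mathlib

section
/- Let K : ℝⁿ → ℝ be smooth away from the origin and homogeneous of degree α - n with 0 < α < n. Then for every f ∈ L¹(ℝⁿ) with ∫ f = 0, the quantity R^{-α} ∫_{R < |x| < 2R} |(K * f)(x)| dx tends to 0 as R → ∞. -/
open MeasureTheory Filter

section HomogeneousKernel

open Set Topology Module
open scoped ENNReal Pointwise

/-- The `L¹` modulus of continuity, over a set `A` of finite measure away from the origin, of a
function which is continuous and has negative power decay away from the origin. -/
theorem tendsto_setLIntegral_enorm_comp_sub_sub {E : Type*} [NormedAddCommGroup E]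
    [MeasurableSpace E] [BorelSpace E] {μ : Measure E} {K : E → ℝ} {β : ℝ}
    (hK : ContinuousOn K {0}ᶜ) (hβ0 : β < 0) {M : ℝ}
    (hM0 : 0 ≤ M) (hM : ∀ x : E, x ≠ 0 → |K x| ≤ M * ‖x‖ ^ β) {A : Set E}
    (hAm : MeasurableSet A) (hA : μ A ≠ ∞) (hA1 : ∀ x ∈ A, 1 < ‖x‖) :
    Tendsto (fun v : E => ∫⁻ u in A, ‖K (u - v) - K u‖ₑ ∂μ) (𝓝 0) (𝓝 0) := by
  have hKm : Measurable K := measurable_of_continuousOn_compl_singleton 0 hK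
  have hlarge : ∀ x : E, 1 / 2 ≤ ‖x‖ → |K x| ≤ M * (1 / 2) ^ β := by
    intro x hx
    have hx0 : x ≠ 0 := by rintro rfl; norm_num at hx
    refine (hM x hx0).trans ?_
    gcongr ?_ * ?_
    exact Real.rpow_le_rpow_of_nonpos (by norm_num) hx hβ0.le
  have key := tendsto_lintegral_filter_of_dominated_convergence (μ := μ.restrict A) (l := 𝓝 (0 : E))
    (F := fun v u => ‖K (u - v) - K u‖ₑ) (f := fun _ => 0)
    (fun _ => ENNReal.ofReal (2 * (M * (1 / 2) ^ β))) ?_ ?_ ?_ ?_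
  · simpa using key
  · exact Eventually.of_forall fun v =>
      ((hKm.comp (measurable_id.sub_const v)).sub hKm).enorm
  · filter_upwards [Metric.ball_mem_nhds (0 : E) (by norm_num : (0 : ℝ) < 1 / 2)] with v hv
    filter_upwards [ae_restrict_mem hAm] with u hu
    have hv' : ‖v‖ < 1 / 2 := by simpa using hv
    have hu1 := hA1 u hu
    have huv := norm_sub_norm_le u v
    rw [Real.enorm_eq_ofReal_abs]
    refine ENNReal.ofReal_le_ofReal ((abs_sub _ _).trans ?_)
    linarith [hlarge (u - v) (by linarith), hlarge u (by linarith)]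
  · rw [setLIntegral_const]
    exact ENNReal.mul_ne_top ENNReal.ofReal_ne_top hA
  · filter_upwards [ae_restrict_mem hAm] with u hu
    have hu0 : u ≠ 0 := by
      rintro rfl
      have := hA1 0 hu
      norm_num at this
    have hc : ContinuousAt K u := hK.continuousAt (isOpen_compl_singleton.mem_nhds hu0)
    have h1 : Tendsto (fun v : E => u - v) (𝓝 0) (𝓝 u) := by
      simpa using (tendsto_const_nhds (x := u)).sub (tendsto_id (x := 𝓝 (0 : E)))
    have h2 : Tendsto (fun v : E => K (u - v) - K u) (𝓝 0) (𝓝 0) := by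
      simpa using (hc.tendsto.comp h1).sub_const (K u)
    simpa using h2.enorm

variable {E : Type*} [NormedAddCommGroup E] [NormedSpace ℝ E]

/-- The shell `R < ‖x‖ < 2 * R` is a dilate of the unit shell. -/
theorem shell_eq_smul_shell {R : ℝ} (hR : 0 < R) :
    {x : E | R < ‖x‖ ∧ ‖x‖ < 2 * R} = R • {x : E | 1 < ‖x‖ ∧ ‖x‖ < 2} := by
  ext x
  rw [Set.mem_smul_set_iff_inv_smul_mem₀ hR.ne']
  simp only [Set.mem_ofPred_eq, norm_smul, norm_inv, Real.norm_eq_abs, abs_of_pos hR]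
  rw [lt_inv_mul_iff₀ hR, inv_mul_lt_iff₀ hR, mul_one, mul_comm R 2]

variable [FiniteDimensional ℝ E] {K : E → ℝ} {β : ℝ}

/-- A positively homogeneous function which is continuous away from the origin is bounded by a
multiple of the corresponding power of the norm. -/
theorem exists_abs_le_mul_rpow_norm_of_homogeneous (hK : ContinuousOn K {0}ᶜ)
    (hhom : ∀ c : ℝ, 0 < c → ∀ x : E, x ≠ 0 → K (c • x) = c ^ β * K x) :
    ∃ M : ℝ, 0 ≤ M ∧ ∀ x : E, x ≠ 0 → |K x| ≤ M * ‖x‖ ^ β := by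
  have hsub : Metric.sphere (0 : E) 1 ⊆ {0}ᶜ := by
    rintro x hx rfl
    simp at hx
  obtain ⟨M, hM⟩ := (isCompact_sphere (0 : E) 1).exists_bound_of_continuousOn (hK.mono hsub)
  refine ⟨max M 0, le_max_right _ _, fun x hx => ?_⟩
  have hx' : 0 < ‖x‖ := norm_pos_iff.2 hx
  have hu : ‖‖x‖⁻¹ • x‖ = 1 := norm_smul_inv_norm (𝕜 := ℝ) hx
  have hKx : K x = ‖x‖ ^ β * K (‖x‖⁻¹ • x) := by
    rw [← hhom ‖x‖ hx' _ (smul_ne_zero (inv_ne_zero hx'.ne') hx), smul_inv_smul₀ hx'.ne']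
  rw [hKx, abs_mul, abs_of_pos (Real.rpow_pos_of_pos hx' β), mul_comm]
  gcongr
  exact (hM _ (by simpa using hu)).trans (le_max_left _ _)

variable [MeasurableSpace E] [BorelSpace E] {μ : Measure E} [μ.IsAddHaarMeasure]

/-- The integral over a set of finite measure of the translates of a function with an integrable
power singularity at the origin is bounded uniformly in the translation. -/
theorem exists_setLIntegral_comp_sub_le (hE : 1 ≤ finrank ℝ E) (hKm : Measurable K)
    (hβ : -(finrank ℝ E : ℝ) < β) (hβ0 : β < 0) {M : ℝ} (hM0 : 0 ≤ M)
    (hM : ∀ x : E, x ≠ 0 → |K x| ≤ M * ‖x‖ ^ β) {A : Set E} (hA : μ A ≠ ∞) :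
    ∃ C : ℝ≥0∞, C ≠ ∞ ∧ ∀ v : E, ∫⁻ u in A, ‖K (u - v)‖ₑ ∂μ ≤ C := by
  have : Nontrivial E := nontrivial_of_finrank_pos (R := ℝ) hE
  have hint : IntegrableOn K (Metric.ball 0 1) μ := by
    refine integrableOn_ball_of_norm_le_rpow (C := M) (α := -β) hE (by linarith) ?_
      hKm.aestronglyMeasurable
    filter_upwards [ae_restrict_of_ae
      (measure_eq_zero_iff_ae_notMem.1 (measure_singleton (μ := μ) (0 : E)))] with x hx
    simpa using hM x hx
  refine ⟨∫⁻ x in Metric.ball 0 1, ‖K x‖ₑ ∂μ + ENNReal.ofReal M * μ A,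
    ENNReal.add_ne_top.2 ⟨hint.2.ne, ENNReal.mul_ne_top ENNReal.ofReal_ne_top hA⟩, fun v => ?_⟩
  set g : E → ℝ≥0∞ := (Metric.ball (0 : E) 1).indicator fun x => ‖K x‖ₑ with hg
  have hgm : Measurable g := hKm.enorm.indicator Metric.isOpen_ball.measurableSet
  have hle : ∀ x : E, ‖K x‖ₑ ≤ g x + ENNReal.ofReal M := by
    intro x
    by_cases hx : x ∈ Metric.ball (0 : E) 1
    · simp [hg, hx]
    · have hx1 : 1 ≤ ‖x‖ := by simpa using hx
      have hx0 : x ≠ 0 := by rintro rfl; norm_num at hx1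
      refine le_add_left ?_
      rw [Real.enorm_eq_ofReal_abs]
      refine ENNReal.ofReal_le_ofReal ((hM x hx0).trans ?_)
      exact mul_le_of_le_one_right hM0 (Real.rpow_le_one_of_one_le_of_nonpos hx1 hβ0.le)
  calc ∫⁻ u in A, ‖K (u - v)‖ₑ ∂μ
      ≤ ∫⁻ u in A, (g (u - v) + ENNReal.ofReal M) ∂μ := lintegral_mono fun u => hle _
    _ = ∫⁻ u in A, g (u - v) ∂μ + ENNReal.ofReal M * μ A := by
        rw [lintegral_add_right _ measurable_const, setLIntegral_const]
    _ ≤ ∫⁻ u, g (u - v) ∂μ + ENNReal.ofReal M * μ A := by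
        gcongr
        exact Measure.restrict_le_self
    _ = _ := by
        rw [lintegral_sub_right_eq_self g v, hg,
          lintegral_indicator Metric.isOpen_ball.measurableSet]

/-- For a mean-zero `f`, the `L¹` norm over `A` of `u ↦ ∫ K (u - h • y) f y` is controlled by the
average against `|f|` of the `L¹` moduli of continuity of `K`. -/
theorem setIntegral_abs_integral_comp_sub_smul_le (hKm : Measurable K) {f : E → ℝ}
    (hf : Integrable f μ) (hf0 : ∫ y, f y ∂μ = 0) (A : Set E) (h : ℝ)
    (hfin : ∫⁻ y, ‖f y‖ₑ * ∫⁻ u in A, ‖K (u - h • y) - K u‖ₑ ∂μ ∂μ ≠ ∞) :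
    ∫ u in A, |∫ y, K (u - h • y) * f y ∂μ| ∂μ ≤
      (∫⁻ y, ‖f y‖ₑ * ∫⁻ u in A, ‖K (u - h • y) - K u‖ₑ ∂μ ∂μ).toReal := by
  have hpt : ∀ u : E, ‖∫ y, K (u - h • y) * f y ∂μ‖ₑ ≤
      ∫⁻ y, ‖f y‖ₑ * ‖K (u - h • y) - K u‖ₑ ∂μ := by
    intro u
    by_cases hi : Integrable (fun y => K (u - h • y) * f y) μ
    · have heq : ∫ y, K (u - h • y) * f y ∂μ = ∫ y, f y * (K (u - h • y) - K u) ∂μ := by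
        have : ∀ y, f y * (K (u - h • y) - K u) = K (u - h • y) * f y - K u * f y :=
          fun y => by ring
        simp_rw [this]
        rw [integral_sub hi (hf.const_mul _), integral_const_mul, hf0, mul_zero, sub_zero]
      rw [heq]
      refine (enorm_integral_le_lintegral_enorm _).trans (le_of_eq ?_)
      simp_rw [enorm_mul]
    · simp [integral_undef hi]
  have hswap : ∫⁻ u in A, ∫⁻ y, ‖f y‖ₑ * ‖K (u - h • y) - K u‖ₑ ∂μ ∂μ =
      ∫⁻ y, ‖f y‖ₑ * ∫⁻ u in A, ‖K (u - h • y) - K u‖ₑ ∂μ ∂μ := by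
    rw [lintegral_lintegral_swap]
    · refine lintegral_congr fun y => ?_
      rw [lintegral_const_mul]
      exact ((hKm.comp (measurable_id.sub_const _)).sub hKm).enorm
    · refine hf.1.enorm.comp_snd.mul (Measurable.aemeasurable ?_)
      exact ((hKm.comp (measurable_fst.sub (measurable_snd.const_smul h))).sub
        (hKm.comp measurable_fst)).enorm
  have hle : ‖∫ u in A, |∫ y, K (u - h • y) * f y ∂μ| ∂μ‖ₑ ≤
      ∫⁻ y, ‖f y‖ₑ * ∫⁻ u in A, ‖K (u - h • y) - K u‖ₑ ∂μ ∂μ := by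
    rw [← hswap]
    refine (enorm_integral_le_lintegral_enorm _).trans (lintegral_mono fun u => ?_)
    simpa using hpt u
  refine (le_abs_self _).trans ?_
  have := ENNReal.toReal_mono hfin hle
  simpa using this

/-- If `f` has mean zero, then `∫ K (u - h • y) f y` tends to zero in `L¹(A)` as `h → 0`, for `A`
of finite measure and away from the origin. -/
theorem tendsto_setIntegral_abs_integral_comp_sub_smul (hE : 1 ≤ finrank ℝ E)
    (hK : ContinuousOn K {0}ᶜ) (hβ : -(finrank ℝ E : ℝ) < β) (hβ0 : β < 0) {M : ℝ}
    (hM0 : 0 ≤ M) (hM : ∀ x : E, x ≠ 0 → |K x| ≤ M * ‖x‖ ^ β) {A : Set E}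
    (hAm : MeasurableSet A) (hA : μ A ≠ ∞) (hA1 : ∀ x ∈ A, 1 < ‖x‖) {f : E → ℝ}
    (hf : Integrable f μ) (hf0 : ∫ y, f y ∂μ = 0) :
    Tendsto (fun h : ℝ => ∫ u in A, |∫ y, K (u - h • y) * f y ∂μ| ∂μ) (𝓝 0) (𝓝 0) := by
  have hKm : Measurable K := measurable_of_continuousOn_compl_singleton 0 hK
  obtain ⟨C, hC, hCle⟩ := exists_setLIntegral_comp_sub_le hE hKm hβ hβ0 hM0 hM hA
  set Φ : E → ℝ≥0∞ := fun v => ∫⁻ u in A, ‖K (u - v) - K u‖ₑ ∂μ with hΦ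
  have hΦm : Measurable Φ :=
    Measurable.lintegral_prod_right' (f := fun p : E × E => ‖K (p.2 - p.1) - K p.2‖ₑ)
      ((hKm.comp (measurable_snd.sub measurable_fst)).sub (hKm.comp measurable_snd)).enorm
  have hΦle : ∀ v, Φ v ≤ C + C := by
    intro v
    calc Φ v ≤ ∫⁻ u in A, (‖K (u - v)‖ₑ + ‖K u‖ₑ) ∂μ := lintegral_mono fun u => enorm_sub_le
      _ = ∫⁻ u in A, ‖K (u - v)‖ₑ ∂μ + ∫⁻ u in A, ‖K u‖ₑ ∂μ :=
          lintegral_add_right _ hKm.enorm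
      _ ≤ C + C := add_le_add (hCle v) (by simpa using hCle 0)
  have hΦ0 : Tendsto Φ (𝓝 0) (𝓝 0) :=
    tendsto_setLIntegral_enorm_comp_sub_sub hK hβ0 hM0 hM hAm hA hA1
  have hbound : ∫⁻ y, ‖f y‖ₑ * (C + C) ∂μ ≠ ∞ := by
    rw [lintegral_mul_const' _ _ (ENNReal.add_ne_top.2 ⟨hC, hC⟩)]
    exact ENNReal.mul_ne_top hf.2.ne (ENNReal.add_ne_top.2 ⟨hC, hC⟩)
  have hlim : Tendsto (fun h : ℝ => ∫⁻ y, ‖f y‖ₑ * Φ (h • y) ∂μ) (𝓝 0) (𝓝 0) := by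
    have key := tendsto_lintegral_filter_of_dominated_convergence' (μ := μ) (l := 𝓝 (0 : ℝ))
      (F := fun h y => ‖f y‖ₑ * Φ (h • y)) (f := fun _ => 0) (fun y => ‖f y‖ₑ * (C + C))
      (Eventually.of_forall fun h =>
        hf.1.enorm.mul (hΦm.comp (measurable_id.const_smul h)).aemeasurable)
      (Eventually.of_forall fun h => ae_of_all _ fun y => by gcongr; exact hΦle _)
      hbound (ae_of_all _ fun y => ?_)
    · simpa using key
    · have h1 : Tendsto (fun h : ℝ => h • y) (𝓝 0) (𝓝 0) := by
        simpa using (tendsto_id (x := 𝓝 (0 : ℝ))).smul_const y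
      simpa using ENNReal.Tendsto.const_mul (hΦ0.comp h1) (Or.inr (enorm_ne_top (x := f y)))
  refine squeeze_zero (fun h => integral_nonneg fun u => abs_nonneg _) (fun h =>
    setIntegral_abs_integral_comp_sub_smul_le hKm hf hf0 A h (ne_top_of_le_ne_top hbound ?_)) ?_
  · exact lintegral_mono fun y => by
      dsimp only
      gcongr
      exact hΦle _
  · exact (ENNReal.tendsto_toReal ENNReal.zero_ne_top).comp hlim

/-- Rescaling of the averages of `K * f` over a dilated set, for a homogeneous kernel `K`. -/
theorem rpow_mul_setIntegral_smul_abs_convolution (hE : 1 ≤ finrank ℝ E)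
    (hhom : ∀ c : ℝ, 0 < c → ∀ x : E, x ≠ 0 → K (c • x) = c ^ β * K x) (A : Set E) (f : E → ℝ)
    {R : ℝ} (hR : 0 < R) :
    R ^ (-(β + finrank ℝ E)) * ∫ x in R • A, |∫ y, K (x - y) * f y ∂μ| ∂μ =
      ∫ u in A, |∫ y, K (u - R⁻¹ • y) * f y ∂μ| ∂μ := by
  have : Nontrivial E := nontrivial_of_finrank_pos (R := ℝ) hE
  have hscale := Measure.setIntegral_comp_smul_of_pos μ
    (fun x => |∫ y, K (x - y) * f y ∂μ|) A hR
  have hpt : ∀ u : E, |∫ y, K (R • u - y) * f y ∂μ| =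
      R ^ β * |∫ y, K (u - R⁻¹ • y) * f y ∂μ| := by
    intro u
    rw [← abs_of_pos (Real.rpow_pos_of_pos hR β), ← abs_mul,
      ← integral_const_mul]
    congr 1
    refine integral_congr_ae ?_
    filter_upwards [measure_eq_zero_iff_ae_notMem.1 (measure_singleton (μ := μ) (R • u))] with y hy
    have hne : u - R⁻¹ • y ≠ 0 := by
      intro h0
      refine hy ?_
      rw [sub_eq_zero.1 h0, smul_inv_smul₀ hR.ne']
      rfl
    rw [← mul_assoc, ← hhom R hR _ hne, smul_sub, smul_inv_smul₀ hR.ne']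
  simp_rw [hpt] at hscale
  rw [integral_const_mul, smul_eq_mul, eq_inv_mul_iff_mul_eq₀ (pow_pos hR _).ne'] at hscale
  rw [← hscale, ← mul_assoc, ← mul_assoc, ← Real.rpow_natCast, ← Real.rpow_add hR,
    ← Real.rpow_add hR]
  simp

end HomogeneousKernel

/-- For a kernel `K` of type `α` (smooth away from the origin,
homogeneous of degree `α - n`, `0 < α < n`) and `f ∈ L¹(ℝⁿ)` with `∫ f = 0`,
`R^{-α} ∫_{R < |x| < 2R} |(K * f)(x)| dx → 0` as `R → ∞`. -/
theorem stmt0 (n : ℕ) (hn : 1 ≤ n) (α : ℝ) (hα0 : 0 < α) (hαn : α < n)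
    (K : EuclideanSpace ℝ (Fin n) → ℝ)
    (hKsmooth : ContDiffOn ℝ (⊤ : ℕ∞) K {(0 : EuclideanSpace ℝ (Fin n))}ᶜ)
    (hKhom : ∀ (c : ℝ), 0 < c → ∀ x : EuclideanSpace ℝ (Fin n), x ≠ 0 →
      K (c • x) = c ^ (α - n) * K x)
    (f : EuclideanSpace ℝ (Fin n) → ℝ) (hf : Integrable f)
    (hf0 : ∫ y, f y = 0) :
    Tendsto (fun R : ℝ =>
        R ^ (-α) * ∫ x in {x : EuclideanSpace ℝ (Fin n) | R < ‖x‖ ∧ ‖x‖ < 2 * R},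
          |∫ y, K (x - y) * f y|)
      atTop (nhds 0) := by
  have hdim : Module.finrank ℝ (EuclideanSpace ℝ (Fin n)) = n := finrank_euclideanSpace_fin
  have hE : 1 ≤ Module.finrank ℝ (EuclideanSpace ℝ (Fin n)) := hdim.symm ▸ hn
  have hK := hKsmooth.continuousOn
  obtain ⟨M, hM0, hM⟩ := exists_abs_le_mul_rpow_norm_of_homogeneous hK hKhom
  set A : Set (EuclideanSpace ℝ (Fin n)) := {x | 1 < ‖x‖ ∧ ‖x‖ < 2} with hA
  have hAm : MeasurableSet A :=
    (measurableSet_lt measurable_const measurable_norm).inter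
      (measurableSet_lt measurable_norm measurable_const)
  have hAfin : volume A ≠ ⊤ := by
    have hsub : A ⊆ Metric.ball 0 2 := fun x hx => by simpa using hx.2
    exact ((measure_mono hsub).trans_lt measure_ball_lt_top).ne
  have hlim := (tendsto_setIntegral_abs_integral_comp_sub_smul (μ := volume) hE hK
    (by rw [hdim]; linarith) (by linarith) hM0 hM hAm hAfin (fun x hx => hx.1) hf hf0).comp
      tendsto_inv_atTop_zero
  refine hlim.congr' ?_
  filter_upwards [eventually_gt_atTop 0] with R hR
  have hscale := rpow_mul_setIntegral_smul_abs_convolution (μ := volume) hE hKhom A f hR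
  rw [hdim, sub_add_cancel] at hscale
  rw [shell_eq_smul_shell hR, hscale, Function.comp_apply]
end

section
/- Let 1 ≤ h < n, let ψ be a compactly supported h-form on ℝⁿ with L¹ coefficients whose distributional exterior derivative dψ also has L¹ coefficients, and let ξ be a constant-coefficient (n−h−1)-form. Then ∫_{ℝⁿ} dψ ∧ ξ = 0. -/
open MeasureTheory

/-- Partial derivative in the `j`-th coordinate direction. -/
noncomputable def pd {n : ℕ} (j : Fin n) (f : EuclideanSpace ℝ (Fin n) → ℝ)
    (x : EuclideanSpace ℝ (Fin n)) : ℝ :=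
  fderiv ℝ f x (EuclideanSpace.single j 1)

/-- Sign of a self-map of `Fin n`: the sign of the permutation if bijective, else `0`. -/
noncomputable def psign {n : ℕ} (p : Fin n → Fin n) : ℝ :=
  if h : Function.Bijective p then ((Equiv.Perm.sign (Equiv.ofBijective p h) : ℤ) : ℝ)
  else 0

/-- An integrable function whose integral against every smooth compactly supported function
with derivative zero on a fixed compact set vanishes has zero integral. -/
theorem integral_eq_zero_of_forall_cutoff {E : Type*} [NormedAddCommGroup E]
    [InnerProductSpace ℝ E] [FiniteDimensional ℝ E] [MeasurableSpace E] [BorelSpace E]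
    {μ : Measure E} {f : E → ℝ} (hf : Integrable f μ) {K : Set E} (hK : IsCompact K)
    (h : ∀ χ : E → ℝ, ContDiff ℝ (⊤ : ℕ∞) χ → HasCompactSupport χ →
      (∀ x ∈ K, fderiv ℝ χ x = 0) → ∫ x, f x * χ x ∂μ = 0) :
    ∫ x, f x ∂μ = 0 := by
  let χ : ℕ → ContDiffBump (0 : E) := fun k =>
    ⟨(k : ℝ) + 1, (k : ℝ) + 2, by positivity, by linarith⟩
  have hlim : Filter.Tendsto (fun k => ∫ x, f x * χ k x ∂μ) Filter.atTop
      (nhds (∫ x, f x ∂μ)) := by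
    refine tendsto_integral_of_dominated_convergence (fun x => ‖f x‖)
      (fun k => hf.aestronglyMeasurable.mul (χ k).continuous.aestronglyMeasurable) hf.norm
      (fun k => Filter.Eventually.of_forall fun x => ?_)
      (Filter.Eventually.of_forall fun x => ?_)
    · rw [norm_mul, Real.norm_of_nonneg (χ k).nonneg]
      exact mul_le_of_le_one_right (norm_nonneg _) (χ k).le_one
    · obtain ⟨N, hN⟩ := exists_nat_ge ‖x‖
      refine tendsto_const_nhds.congr' ?_
      filter_upwards [Filter.eventually_ge_atTop N] with k hk
      have hNk : (N : ℝ) ≤ k := by exact_mod_cast hk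
      rw [(χ k).one_of_mem_closedBall, mul_one]
      rw [mem_closedBall_zero_iff]
      change ‖x‖ ≤ (k : ℝ) + 1
      linarith
  obtain ⟨R, hR⟩ := hK.isBounded.exists_norm_le
  obtain ⟨N, hN⟩ := exists_nat_ge R
  refine tendsto_nhds_unique hlim (tendsto_const_nhds.congr' ?_)
  filter_upwards [Filter.eventually_ge_atTop N] with k hk
  have hNk : (N : ℝ) ≤ k := by exact_mod_cast hk
  refine (h (χ k) (χ k).contDiff (χ k).hasCompactSupport fun x hx => ?_).symm
  have hone : (χ k : E → ℝ) =ᶠ[nhds x] fun _ => (1 : ℝ) := by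
    refine (χ k).eventuallyEq_one_of_mem_ball ?_
    rw [mem_ball_zero_iff]
    change ‖x‖ < (k : ℝ) + 1
    linarith [hR x hx]
  rw [hone.fderiv_eq, fderiv_fun_const, Pi.zero_apply]

/-- let `1 ≤ h < n`, let `ψ` be a compactly supported `h`-form with
`L¹` coefficients whose distributional exterior derivative `dψ = η` also has `L¹`
coefficients, and let `ξ` be a constant-coefficient `(n-h-1)`-form. Then
`∫ dψ ∧ ξ = 0`, the wedge integral written in coefficients as
`Σ_{I,J} ξ_J ε(I⌢J) ∫ η_I`. -/
theorem stmt18 (n h : ℕ) (h1 : 1 ≤ h) (hhn : h < n)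
    (ψ : (Fin h → Fin n) → EuclideanSpace ℝ (Fin n) → ℝ)
    (hψ : ∀ I, Integrable (ψ I) volume)
    (hψc : ∀ I, HasCompactSupport (ψ I))
    (η : (Fin (h + 1) → Fin n) → EuclideanSpace ℝ (Fin n) → ℝ)
    (hη : ∀ I, Integrable (η I) volume)
    (hdψ : ∀ I : Fin (h + 1) → Fin n,
      ∀ χ : EuclideanSpace ℝ (Fin n) → ℝ, ContDiff ℝ (⊤ : ℕ∞) χ → HasCompactSupport χ →
        ∫ x, η I x * χ x =
          -∑ i : Fin (h + 1), (-1 : ℝ) ^ (i : ℕ) *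
            ∫ x, ψ (fun j => I (i.succAbove j)) x * pd (I i) χ x)
    (ξ : (Fin (n - (h + 1)) → Fin n) → ℝ) :
    ∑ I : Fin (h + 1) → Fin n, ∑ J : Fin (n - (h + 1)) → Fin n,
      ξ J * psign (fun p => Fin.append I J (Fin.cast (by omega) p)) * ∫ x, η I x
      = 0 := by
  refine Finset.sum_eq_zero fun I _ => Finset.sum_eq_zero fun J _ => ?_
  rw [integral_eq_zero_of_forall_cutoff (hη I) (isCompact_iUnion hψc), mul_zero]
  intro χ hχ hχc hχd
  rw [hdψ I χ hχ hχc, neg_eq_zero]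
  refine Finset.sum_eq_zero fun i _ => mul_eq_zero_of_right _ (integral_eq_zero_of_ae ?_)
  refine Filter.Eventually.of_forall fun x => ?_
  by_cases hx : x ∈ tsupport (ψ fun j => I (i.succAbove j))
  · simp [pd, hχd x (Set.mem_iUnion_of_mem _ hx)]
  · simp [image_eq_zero_of_notMem_tsupport hx]
end
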